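/- Assume F is monotone and Lipschitz in each argument with constant L_F, A is nondecreasing and Lipschitz with constant L_A, and the CFL condition 2 L_F Δt/Δx + (2^{λ+1} c L_A/λ) Δt/Δx^λ ≤ 1 holds. Then the explicit scheme is an ℓ¹-contraction: for any two bounded sequences U, V : ℤ → ℝ with Σ_{i∈ℤ} |U_i − V_i| < ∞, one has Σ_{i∈ℤ} |H(U)_i − H(V)_i| ≤ Σ_{i∈ℤ} |U_i − V_i|. In particular (taking V ≡ 0, for which H(V) = 0) every bounded U with Σ_i |U_i| < ∞ satisfies Σ_i |H(U)_i| ≤ Σ_i |U_i|, which is the discrete L¹ bound of Theorem 3.1(ii). -/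

import Mathlib

open MeasureTheory

/-- The finite-difference weights `G_j = c ∫_{(|j|−1/2)Δx}^{(|j|+1/2)Δx} z^{−1−λ} dz`
discretizing the one-dimensional fractional Laplacian. -/
noncomputable def fracWeight (c lam Δx : ℝ) (j : ℤ) : ℝ :=
  ∫ z in ((|j| : ℝ) - 1/2) * Δx..((|j| : ℝ) + 1/2) * Δx, c * z ^ (-1 - lam)

/-- The one-step explicit finite-difference operator
`H(U)_i = U_i − (Δt/Δx)(F(U_i,U_{i+1}) − F(U_{i−1},U_i))
          + Δt ∑_{j≠0} G_j (A(U_{i+j}) − A(U_i))`. -/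
noncomputable def schemeH (c lam Δx Δt : ℝ) (F : ℝ → ℝ → ℝ) (A : ℝ → ℝ)
    (U : ℤ → ℝ) (i : ℤ) : ℝ :=
  U i - Δt / Δx * (F (U i) (U (i + 1)) - F (U (i - 1)) (U i))
    + Δt * ∑' j : {j : ℤ // j ≠ 0}, fracWeight c lam Δx j.1 * (A (U (i + j.1)) - A (U i))


lemma fracWeight_nat (c lam Δx : ℝ) (hlam : 0 < lam) (hΔx : 0 < Δx) (n : ℕ) :
    fracWeight c lam Δx ((n : ℤ) + 1) =
      c / lam * (((n : ℝ) + 1/2) * Δx) ^ (-lam)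
        - c / lam * (((n + 1 : ℕ) + 1/2 : ℝ) * Δx) ^ (-lam) := by
  have hn : (0 : ℝ) ≤ n := Nat.cast_nonneg n
  have habs : |(((n : ℤ) + 1 : ℤ) : ℝ)| = (n : ℝ) + 1 := by
    push_cast
    exact abs_of_nonneg (by linarith)
  unfold fracWeight
  rw [habs, intervalIntegral.integral_const_mul, integral_rpow]
  · have e1 : (-1 - lam + 1) = -lam := by ring
    have e2 : ((n : ℝ) + 1 - 1/2) = n + 1/2 := by ring
    rw [e1, e2]
    push_cast
    field_simp
    ring
  · right
    refine ⟨by linarith, ?_⟩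
    have h1 : 0 < ((n : ℝ) + 1 - 1/2) * Δx := mul_pos (by linarith) hΔx
    have h2 : 0 < ((n : ℝ) + 1 + 1/2) * Δx := mul_pos (by linarith) hΔx
    intro h
    rw [Set.mem_uIcc] at h
    rcases h with h | h <;> linarith [h.1, h.2]

lemma fracWeight_neg (c lam Δx : ℝ) (j : ℤ) :
    fracWeight c lam Δx (-j) = fracWeight c lam Δx j := by
  unfold fracWeight
  simp

lemma fracWeight_nat_nonneg (c lam Δx : ℝ) (hc : 0 < c) (hlam : 0 < lam) (hΔx : 0 < Δx) (n : ℕ) :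
    0 ≤ fracWeight c lam Δx ((n : ℤ) + 1) := by
  rw [fracWeight_nat c lam Δx hlam hΔx]
  have hn : (0 : ℝ) ≤ n := Nat.cast_nonneg n
  rw [← mul_sub]
  refine mul_nonneg (by positivity) (sub_nonneg.2 ?_)
  refine Real.rpow_le_rpow_of_nonpos (by positivity) ?_ (by linarith)
  push_cast
  nlinarith

lemma fracWeight_nonneg (c lam Δx : ℝ) (hc : 0 < c) (hlam : 0 < lam) (hΔx : 0 < Δx) (j : ℤ)
    (hj : j ≠ 0) : 0 ≤ fracWeight c lam Δx j := by
  have key : ∀ j : ℤ, 0 < j → 0 ≤ fracWeight c lam Δx j := by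
    intro j hj
    have := fracWeight_nat_nonneg c lam Δx hc hlam hΔx (j - 1).toNat
    rwa [Int.toNat_of_nonneg (by omega), sub_add_cancel] at this
  rcases lt_or_gt_of_ne hj with h | h
  · rw [← fracWeight_neg]
    exact key _ (by omega)
  · exact key _ h

lemma fracWeight_hasSum_nat (c lam Δx : ℝ) (hc : 0 < c) (hlam : 0 < lam) (hΔx : 0 < Δx) :
    HasSum (fun n : ℕ => fracWeight c lam Δx ((n : ℤ) + 1)) (c / lam * (Δx / 2) ^ (-lam)) := by
  rw [hasSum_iff_tendsto_nat_of_nonneg (fracWeight_nat_nonneg c lam Δx hc hlam hΔx)]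
  have h : ∀ N : ℕ, ∑ n ∈ Finset.range N, fracWeight c lam Δx ((n : ℤ) + 1) =
      c / lam * (Δx / 2) ^ (-lam) - c / lam * (((N : ℝ) + 1/2) * Δx) ^ (-lam) := by
    intro N
    rw [Finset.sum_congr rfl (fun n _ => fracWeight_nat c lam Δx hlam hΔx n)]
    rw [Finset.sum_range_sub' (fun n : ℕ => c / lam * (((n : ℝ) + 1/2) * Δx) ^ (-lam)) N]
    congr 3
    push_cast
    ring
  simp_rw [h]
  have ht : Filter.Tendsto (fun N : ℕ => (((N : ℝ) + 1/2) * Δx)) Filter.atTop Filter.atTop :=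
    (Filter.tendsto_atTop_add_const_right _ _ tendsto_natCast_atTop_atTop).atTop_mul_const hΔx
  have h0 := ((tendsto_rpow_neg_atTop hlam).comp ht).const_mul (c / lam)
  have := (tendsto_const_nhds (x := c / lam * (Δx / 2) ^ (-lam))).sub h0
  simpa using this

lemma fracWeight_hasSum (c lam Δx : ℝ) (hc : 0 < c) (hlam : 0 < lam) (hΔx : 0 < Δx) :
    HasSum (fun j : {j : ℤ // j ≠ 0} => fracWeight c lam Δx j.1)
      (2 ^ (lam + 1) * c / (lam * Δx ^ lam)) := by
  have hs := fracWeight_hasSum_nat c lam Δx hc hlam hΔx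
  have hval : 2 ^ (lam + 1) * c / (lam * Δx ^ lam) =
      c / lam * (Δx / 2) ^ (-lam) + c / lam * (Δx / 2) ^ (-lam) := by
    rw [Real.rpow_neg (by positivity), Real.div_rpow hΔx.le (by norm_num),
      Real.rpow_add (by norm_num), Real.rpow_one]
    have : (0 : ℝ) < Δx ^ lam := by positivity
    have : (0 : ℝ) < 2 ^ lam := by positivity
    field_simp
    ring
  rw [hval]
  have := hasSum_subtype_iff_indicator (f := fracWeight c lam Δx) (s := {j : ℤ | j ≠ 0})
    (a := c / lam * (Δx / 2) ^ (-lam) + c / lam * (Δx / 2) ^ (-lam))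
  refine this.2 ?_
  refine HasSum.of_nat_of_neg_add_one ?_ ?_
  · rw [← hasSum_nat_add_iff' 1]
    convert hs using 1
    · rfl
    · funext n
      rw [Set.indicator_of_mem]
      · push_cast; rfl
      · show ((n + 1 : ℕ) : ℤ) ≠ 0
        omega
    · simp
  · convert hs using 1
    funext n
    rw [Set.indicator_of_mem, fracWeight_neg]
    show -((n : ℤ) + 1) ≠ 0
    omega

/-- Same-sign absorption. -/
lemma abs_sub_absorb (w x : ℝ) (h1 : 0 ≤ w → 0 ≤ x) (h2 : w ≤ 0 → x ≤ 0) (h : |x| ≤ |w|) :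
    |w - x| = |w| - |x| := by
  rcases le_total 0 w with hw | hw
  · have hx := h1 hw
    rw [abs_of_nonneg hw, abs_of_nonneg hx] at *
    rw [abs_of_nonneg (by linarith)]
  · have hx := h2 hw
    rw [abs_of_nonpos hw, abs_of_nonpos hx] at *
    rw [abs_of_nonpos (by linarith)]
    ring

lemma hasSum_conv (G : {j : ℤ // j ≠ 0} → ℝ) (S : ℝ) (hG : HasSum G S) (hG0 : ∀ j, 0 ≤ G j)
    (e : ℤ → ℝ) (he0 : ∀ i, 0 ≤ e i) (D : ℝ) (he : HasSum e D) :
    HasSum (fun i => ∑' j, G j * e (i + j.1)) (D * S) := by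
  have hsum : Summable (fun x : ℤ × {j : ℤ // j ≠ 0} => e x.1 * G x.2) :=
    he.summable.mul_of_nonneg hG.summable he0 hG0
  have hp : HasSum (fun x : ℤ × {j : ℤ // j ≠ 0} => e x.1 * G x.2) (D * S) := he.mul hG hsum
  let E : ℤ × {j : ℤ // j ≠ 0} ≃ ℤ × {j : ℤ // j ≠ 0} :=
    { toFun := fun x => (x.1 + x.2.1, x.2)
      invFun := fun x => (x.1 - x.2.1, x.2)
      left_inv := fun x => by simp
      right_inv := fun x => by simp }
  have hp2 := (E.hasSum_iff).2 hp
  have hf := hp2.prod_fiberwise (fun i => (hp2.summable.prod_factor i).hasSum)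
  convert hf using 1
  funext i
  exact tsum_congr fun j => mul_comm _ _

lemma scheme_aux
    (lam c Δx Δt : ℝ) (hlam₀ : 0 < lam) (hc : 0 < c)
    (hΔx : 0 < Δx) (hΔt : 0 < Δt)
    (F : ℝ → ℝ → ℝ) (A : ℝ → ℝ) (LF LA : ℝ)
    (hFmono₁ : ∀ v, Monotone fun u => F u v)
    (hFmono₂ : ∀ u, Antitone fun v => F u v)
    (hFlip₁ : ∀ u u' v, |F u v - F u' v| ≤ LF * |u - u'|)
    (hFlip₂ : ∀ u v v', |F u v - F u v'| ≤ LF * |v - v'|)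
    (hAmono : Monotone A)
    (hAlip : ∀ a b, |A a - A b| ≤ LA * |a - b|)
    (hCFL : 2 * LF * Δt / Δx + 2 ^ (lam + 1) * c * LA / lam * (Δt / Δx ^ lam) ≤ 1)
    (U V : ℤ → ℝ) (hU : ∃ K : ℝ, ∀ i, |U i| ≤ K) (hV : ∃ K : ℝ, ∀ i, |V i| ≤ K)
    (hUV : Summable (fun i => |U i - V i|)) :
    Summable (fun i => |schemeH c lam Δx Δt F A U i - schemeH c lam Δx Δt F A V i|) ∧
      (∑' i, |schemeH c lam Δx Δt F A U i - schemeH c lam Δx Δt F A V i|)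
        ≤ ∑' i, |U i - V i| := by
  have hG := fracWeight_hasSum c lam Δx hc hlam₀ hΔx
  have hG0 : ∀ j : {j : ℤ // j ≠ 0}, 0 ≤ fracWeight c lam Δx j.1 := fun j =>
    fracWeight_nonneg c lam Δx hc hlam₀ hΔx j.1 j.2
  set S := 2 ^ (lam + 1) * c / (lam * Δx ^ lam) with hS
  have hS0 : 0 ≤ S := by positivity
  set r := Δt / Δx with hr
  have hr0 : 0 ≤ r := by positivity
  have hCFL' : r * LF + r * LF + Δt * S * LA ≤ 1 := by
    have h1 : (0 : ℝ) < Δx ^ lam := by positivity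
    refine le_of_eq_of_le ?_ hCFL
    rw [hr, hS]
    field_simp
    ring
  have hLA : 0 ≤ LA := by
    have := (abs_nonneg _).trans (hAlip 1 0)
    simpa using this
  -- summability of the nonlocal sums
  have hsumA : ∀ W : ℤ → ℝ, (∃ K : ℝ, ∀ i, |W i| ≤ K) → ∀ i, Summable
      (fun j : {j : ℤ // j ≠ 0} => fracWeight c lam Δx j.1 * (A (W (i + j.1)) - A (W i))) := by
    rintro W ⟨K, hK⟩ i
    refine Summable.of_norm_bounded (g := fun j => fracWeight c lam Δx j.1 * (LA * (K + K)))
      (hG.summable.mul_right _) ?_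
    intro j
    rw [Real.norm_eq_abs, abs_mul, abs_of_nonneg (hG0 j)]
    refine mul_le_mul_of_nonneg_left ((hAlip _ _).trans ?_) (hG0 j)
    refine mul_le_mul_of_nonneg_left ?_ hLA
    exact (abs_sub _ _).trans (add_le_add (hK _) (hK _))
  let w : ℤ → ℝ := fun i => U i - V i
  let p : ℤ → ℝ := fun i => F (U i) (U (i + 1)) - F (V i) (U (i + 1))
  let q : ℤ → ℝ := fun i => F (V (i - 1)) (V i) - F (V (i - 1)) (U i)
  let d : ℤ → ℝ := fun i => A (U i) - A (V i)
  have hp : ∀ i, |p i| ≤ LF * |w i| := fun i => hFlip₁ _ _ _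
  have hq : ∀ i, |q i| ≤ LF * |w i| := fun i => by
    have := hFlip₂ (V (i - 1)) (V i) (U i)
    rwa [abs_sub_comm (V i)] at this
  have hd : ∀ i, |d i| ≤ LA * |w i| := fun i => hAlip _ _
  have hp1 : ∀ i, 0 ≤ w i → 0 ≤ p i := fun i h => sub_nonneg.2 (hFmono₁ _ (sub_nonneg.1 h))
  have hp2 : ∀ i, w i ≤ 0 → p i ≤ 0 := fun i h => sub_nonpos.2 (hFmono₁ _ (sub_nonpos.1 h))
  have hq1 : ∀ i, 0 ≤ w i → 0 ≤ q i := fun i h => sub_nonneg.2 (hFmono₂ _ (sub_nonneg.1 h))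
  have hq2 : ∀ i, w i ≤ 0 → q i ≤ 0 := fun i h => sub_nonpos.2 (hFmono₂ _ (sub_nonpos.1 h))
  have hd1 : ∀ i, 0 ≤ w i → 0 ≤ d i := fun i h => sub_nonneg.2 (hAmono (sub_nonneg.1 h))
  have hd2 : ∀ i, w i ≤ 0 → d i ≤ 0 := fun i h => sub_nonpos.2 (hAmono (sub_nonpos.1 h))
  have sp : Summable fun i => |p i| :=
    Summable.of_nonneg_of_le (fun _ => abs_nonneg _) hp (hUV.mul_left LF)
  have sq : Summable fun i => |q i| :=
    Summable.of_nonneg_of_le (fun _ => abs_nonneg _) hq (hUV.mul_left LF)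
  have sd : Summable fun i => |d i| :=
    Summable.of_nonneg_of_le (fun _ => abs_nonneg _) hd (hUV.mul_left LA)
  have hconv := hasSum_conv _ S hG hG0 (fun i => |d i|) (fun _ => abs_nonneg _) _ sd.hasSum
  have sdi : ∀ i, Summable fun j : {j : ℤ // j ≠ 0} => fracWeight c lam Δx j.1 * |d (i + j.1)| := by
    intro i
    refine Summable.of_nonneg_of_le (fun j => mul_nonneg (hG0 j) (abs_nonneg _)) (fun j => ?_)
      (hG.summable.mul_right (∑' k, |d k|))
    exact mul_le_mul_of_nonneg_left (sd.le_tsum (i + j.1) (fun _ _ => abs_nonneg _)) (hG0 j)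
  have sdi' : ∀ i, Summable fun j : {j : ℤ // j ≠ 0} => fracWeight c lam Δx j.1 * d (i + j.1) := by
    intro i
    refine Summable.of_norm_bounded (sdi i) (fun j => ?_)
    rw [Real.norm_eq_abs, abs_mul, abs_of_nonneg (hG0 j)]
  -- decomposition
  have hdec : ∀ i, schemeH c lam Δx Δt F A U i - schemeH c lam Δx Δt F A V i =
      (w i - (r * p i + r * q i + Δt * S * d i)) + r * q (i + 1) + r * p (i - 1)
        + Δt * ∑' j : {j : ℤ // j ≠ 0}, fracWeight c lam Δx j.1 * d (i + j.1) := by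
    intro i
    have h1 : (∑' j : {j : ℤ // j ≠ 0}, fracWeight c lam Δx j.1 * (A (U (i + j.1)) - A (U i)))
        - (∑' j : {j : ℤ // j ≠ 0}, fracWeight c lam Δx j.1 * (A (V (i + j.1)) - A (V i)))
        = (∑' j : {j : ℤ // j ≠ 0}, fracWeight c lam Δx j.1 * d (i + j.1)) - S * d i := by
      rw [← (hsumA U hU i).tsum_sub (hsumA V hV i), ← (hG.mul_right (d i)).tsum_eq,
        ← (sdi' i).tsum_sub (hG.summable.mul_right (d i))]
      refine tsum_congr fun j => ?_
      simp only [d]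
      ring
    have h2 : i + 1 - 1 = i := by ring
    have h3 : i - 1 + 1 = i := by ring
    unfold schemeH
    simp only [w, p, q, h2, h3]
    linear_combination Δt * h1
  have hmain : ∀ i, |w i - (r * p i + r * q i + Δt * S * d i)| =
      |w i| - (r * |p i| + r * |q i| + Δt * S * |d i|) := by
    intro i
    have hc0 : 0 ≤ Δt * S := by positivity
    have habs : |r * p i + r * q i + Δt * S * d i| = r * |p i| + r * |q i| + Δt * S * |d i| := by
      rcases le_total 0 (w i) with h | h
      · have a := hp1 i h
        have b := hq1 i h
        have c := hd1 i h
        rw [abs_of_nonneg a, abs_of_nonneg b, abs_of_nonneg c, abs_of_nonneg (by positivity)]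
      · have a := mul_nonpos_of_nonneg_of_nonpos hr0 (hp2 i h)
        have b := mul_nonpos_of_nonneg_of_nonpos hr0 (hq2 i h)
        have c := mul_nonpos_of_nonneg_of_nonpos hc0 (hd2 i h)
        rw [abs_of_nonpos (hp2 i h), abs_of_nonpos (hq2 i h), abs_of_nonpos (hd2 i h),
          abs_of_nonpos (by linarith)]
        ring
    rw [abs_sub_absorb, habs]
    · intro h
      have a := hp1 i h
      have b := hq1 i h
      have c := hd1 i h
      positivity
    · intro h
      have a := mul_nonpos_of_nonneg_of_nonpos hr0 (hp2 i h)
      have b := mul_nonpos_of_nonneg_of_nonpos hr0 (hq2 i h)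
      have c := mul_nonpos_of_nonneg_of_nonpos hc0 (hd2 i h)
      linarith
    · rw [habs]
      have a := mul_le_mul_of_nonneg_left (hp i) hr0
      have b := mul_le_mul_of_nonneg_left (hq i) hr0
      have c := mul_le_mul_of_nonneg_left (hd i) hc0
      have e := mul_le_mul_of_nonneg_right hCFL' (abs_nonneg (w i))
      linarith
  have hbound : ∀ i, |schemeH c lam Δx Δt F A U i - schemeH c lam Δx Δt F A V i| ≤
      (|w i| - (r * |p i| + r * |q i| + Δt * S * |d i|)) + r * |q (i + 1)| + r * |p (i - 1)|
        + Δt * ∑' j : {j : ℤ // j ≠ 0}, fracWeight c lam Δx j.1 * |d (i + j.1)| := by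
    intro i
    rw [hdec i, ← hmain i]
    refine (abs_add_le _ _).trans (add_le_add ((abs_add_le _ _).trans
      (add_le_add ((abs_add_le _ _).trans (add_le_add le_rfl ?_)) ?_)) ?_)
    · rw [abs_mul, abs_of_nonneg hr0]
    · rw [abs_mul, abs_of_nonneg hr0]
    · rw [abs_mul, abs_of_nonneg hΔt.le]
      refine mul_le_mul_of_nonneg_left ?_ hΔt.le
      rw [← Real.norm_eq_abs]
      refine tsum_of_norm_bounded (sdi i).hasSum (fun j => ?_)
      rw [Real.norm_eq_abs, abs_mul, abs_of_nonneg (hG0 j)]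
  have hq' : HasSum (fun i => |q (i + 1)|) (∑' i, |q i|) :=
    ((Equiv.addRight (1 : ℤ)).hasSum_iff (f := fun i => |q i|)).2 sq.hasSum
  have hp' : HasSum (fun i => |p (i - 1)|) (∑' i, |p i|) :=
    ((Equiv.subRight (1 : ℤ)).hasSum_iff (f := fun i => |p i|)).2 sp.hasSum
  have htot := ((((hUV.hasSum.sub (((sp.hasSum.mul_left r).add (sq.hasSum.mul_left r)).add
    (sd.hasSum.mul_left (Δt * S)))).add (hq'.mul_left r)).add (hp'.mul_left r)).add
    (hconv.mul_left Δt))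
  have hs : Summable (fun i => |schemeH c lam Δx Δt F A U i - schemeH c lam Δx Δt F A V i|) :=
    Summable.of_nonneg_of_le (fun _ => abs_nonneg _) hbound htot.summable
  refine ⟨hs, ?_⟩
  refine (hasSum_le hbound hs.hasSum htot).trans (le_of_eq ?_)
  ring

/-- the explicit scheme is an `ℓ¹`-contraction under the CFL
condition: `∑_i |H(U)_i − H(V)_i| ≤ ∑_i |U_i − V_i|`; in particular (taking
`V ≡ 0`, for which `H(V) = 0`) one has `∑_i |H(U)_i| ≤ ∑_i |U_i|`. -/
theorem explicit_scheme_l1_contraction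
    (lam c Δx Δt : ℝ) (hlam₀ : 0 < lam) (hlam₂ : lam < 2) (hc : 0 < c)
    (hΔx : 0 < Δx) (hΔt : 0 < Δt)
    (F : ℝ → ℝ → ℝ) (A : ℝ → ℝ) (LF LA : ℝ)
    (hFmono₁ : ∀ v, Monotone fun u => F u v)
    (hFmono₂ : ∀ u, Antitone fun v => F u v)
    (hFlip₁ : ∀ u u' v, |F u v - F u' v| ≤ LF * |u - u'|)
    (hFlip₂ : ∀ u v v', |F u v - F u v'| ≤ LF * |v - v'|)
    (hAmono : Monotone A)
    (hAlip : ∀ a b, |A a - A b| ≤ LA * |a - b|)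
    (hCFL : 2 * LF * Δt / Δx + 2 ^ (lam + 1) * c * LA / lam * (Δt / Δx ^ lam) ≤ 1) :
    (∀ U V : ℤ → ℝ, (∃ K : ℝ, ∀ i, |U i| ≤ K) → (∃ K : ℝ, ∀ i, |V i| ≤ K) →
      Summable (fun i => |U i - V i|) →
      Summable (fun i => |schemeH c lam Δx Δt F A U i - schemeH c lam Δx Δt F A V i|) ∧
      (∑' i, |schemeH c lam Δx Δt F A U i - schemeH c lam Δx Δt F A V i|)
        ≤ ∑' i, |U i - V i|) ∧
    (∀ U : ℤ → ℝ, (∃ K : ℝ, ∀ i, |U i| ≤ K) → Summable (fun i => |U i|) →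
      Summable (fun i => |schemeH c lam Δx Δt F A U i|) ∧
      (∑' i, |schemeH c lam Δx Δt F A U i|) ≤ ∑' i, |U i|) := by
  have key := scheme_aux lam c Δx Δt hlam₀ hc hΔx hΔt F A LF LA hFmono₁ hFmono₂ hFlip₁ hFlip₂
    hAmono hAlip hCFL
  refine ⟨key, fun U hU hs => ?_⟩
  have h0 : ∀ i, schemeH c lam Δx Δt F A (fun _ => 0) i = 0 := by
    intro i
    simp [schemeH]
  have := key U (fun _ => 0) hU ⟨0, by simp⟩ (by simpa using hs)
  simpa [h0] using this
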